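/- Let Ω ⊆ ℝ³ be a bounded open set with smooth boundary such that Ω and ℍ¹ ∖ closure(Ω) satisfy the uniform exterior ball property, let ξ ∈ Ω, and let H be a regular part of the Green's function of Ω at ξ (H continuous on the closure of Ω, Δ_ℍ H = 0 on Ω, H = Γ_ξ on ∂Ω) with H(ξ) > 0, with harmonic radius r_Ω(ξ) = 1/√(8π H(ξ)). Then r_Ω(ξ) ≤ α_Ω(ξ) · (2|Ω|/π²)^{1/4}, where α_Ω(ξ) = (sup_{η∈∂Ω} d(ξ,η))/(inf_{η∈∂Ω} d(ξ,η)). -/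

import Mathlib

open MeasureTheory Real Set

noncomputable section

/-- The underlying space of the Heisenberg group ℍ¹: ℝ³ with coordinates (x, y, t). -/
abbrev H1 : Type := ℝ × ℝ × ℝ

/-- The Koranyi norm ρ(x,y,t) = ((x²+y²)² + t²)^{1/4}. -/
def ρH (η : H1) : ℝ := ((η.1 ^ 2 + η.2.1 ^ 2) ^ 2 + η.2.2 ^ 2) ^ ((1 : ℝ) / 4)

/-- The Heisenberg group law: η∘ξ = (x+x₀, y+y₀, t+t₀+2(x₀y − x y₀)). -/
def hmul (η ξ : H1) : H1 :=
  (η.1 + ξ.1, η.2.1 + ξ.2.1, η.2.2 + ξ.2.2 + 2 * (ξ.1 * η.2.1 - η.1 * ξ.2.1))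

/-- The Heisenberg group inverse: ξ⁻¹ = (−x₀,−y₀,−t₀). -/
def hinv (ξ : H1) : H1 := (-ξ.1, -ξ.2.1, -ξ.2.2)

/-- The Koranyi distance d(ξ,η) = ρ(ξ⁻¹∘η). -/
def kd (ξ η : H1) : ℝ := ρH (hmul (hinv ξ) η)

/-- The Koranyi ball B(ξ,r) = {η : d(ξ,η) < r}. -/
def kball (ξ : H1) (r : ℝ) : Set H1 := {η | kd ξ η < r}

/-- Horizontal derivative Xu = ∂u/∂x + 2y·∂u/∂t, as the derivative along (1,0,2y). -/
def Xd (u : H1 → ℝ) (η : H1) : ℝ := fderiv ℝ u η (1, 0, 2 * η.2.1)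

/-- Horizontal derivative Yu = ∂u/∂y − 2x·∂u/∂t, as the derivative along (0,1,−2x). -/
def Yd (u : H1 → ℝ) (η : H1) : ℝ := fderiv ℝ u η (0, 1, -2 * η.1)

/-- The Kohn-Laplacian Δ_ℍ u = X(Xu) + Y(Yu). -/
def kohn (u : H1 → ℝ) (η : H1) : ℝ := Xd (Xd u) η + Yd (Yd u) η

/-- The fundamental solution with pole ξ: Γ_ξ(η) = 1/(8π d(ξ,η)²). -/
def Γξ (ξ η : H1) : ℝ := 1 / (8 * π * kd ξ η ^ 2)

/-- A set A satisfies the uniform exterior ball property if there exists r₀ > 0 such that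
for every ζ ∈ ∂A and every r ∈ (0,r₀] there exists η with B(η,r) ∩ A = ∅ and ζ ∈ ∂B(η,r). -/
def uebp (A : Set H1) : Prop :=
  ∃ r₀ > (0 : ℝ), ∀ ζ ∈ frontier A, ∀ r : ℝ, 0 < r → r ≤ r₀ →
    ∃ η : H1, kball η r ∩ A = ∅ ∧ ζ ∈ frontier (kball η r)

/-- Ω has C¹ boundary: it is the sublevel set of a C¹ defining function with
nonvanishing gradient on the boundary. -/
def c1Bdry (Ω : Set H1) : Prop :=
  ∃ f : H1 → ℝ, ContDiff ℝ 1 f ∧ Ω = {x | f x < 0} ∧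
    frontier Ω = {x | f x = 0} ∧ ∀ x ∈ frontier Ω, fderiv ℝ f x ≠ 0

/-- Ω has smooth boundary: it is the sublevel set of a smooth defining function with
nonvanishing gradient on the boundary. -/
def smoothBdry (Ω : Set H1) : Prop :=
  ∃ f : H1 → ℝ, ContDiff ℝ (⊤ : ℕ∞) f ∧ Ω = {x | f x < 0} ∧
    frontier Ω = {x | f x = 0} ∧ ∀ x ∈ frontier Ω, fderiv ℝ f x ≠ 0

/-- The horizontal perimeter of Ω:
P_ℍ(Ω) = sup { ∫_Ω (Xa + Yb) : a,b of class C¹ with a²+b² ≤ 1 }. -/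
def horizPerim (Ω : Set H1) : ℝ :=
  sSup { p : ℝ | ∃ a b : H1 → ℝ, ContDiff ℝ 1 a ∧ ContDiff ℝ 1 b ∧
    (∀ η, a η ^ 2 + b η ^ 2 ≤ 1) ∧ p = ∫ η in Ω, (Xd a η + Yd b η) }

/-- The first Dirichlet eigenvalue of the Kohn-Laplacian on Ω, via the Rayleigh quotient. -/
def lam1 (Ω : Set H1) : ℝ :=
  sInf { q : ℝ | ∃ v : H1 → ℝ, ContDiff ℝ (⊤ : ℕ∞) v ∧ HasCompactSupport v ∧ tsupport v ⊆ Ω ∧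
    v ≠ 0 ∧ q = (∫ η in Ω, ((Xd v η) ^ 2 + (Yd v η) ^ 2)) / (∫ η in Ω, (v η) ^ 2) }

/-- The Bessel function of the first kind of order 1,
J₁(l) = (l/2)·Σ_{k=0}^∞ ((−1)^k/(k!·(k+1)!))·(l/2)^{2k}. -/
def J1 (l : ℝ) : ℝ :=
  (l / 2) * ∑' k : ℕ,
    ((-1 : ℝ) ^ k / ((Nat.factorial k : ℝ) * (Nat.factorial (k + 1) : ℝ))) * (l / 2) ^ (2 * k)

theorem deriv_deriv_nonneg_of_isLocalMin {g : ℝ → ℝ} {a : ℝ} (hg : ContinuousAt g a)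
    (h : IsLocalMin g a) : 0 ≤ deriv (deriv g) a := by
  by_contra! hneg
  have hmax : IsLocalMax g a := isLocalMax_of_deriv_deriv_neg hneg h.deriv_eq_zero hg
  have hconst : g =ᶠ[nhds a] fun _ => g a := by
    filter_upwards [h, hmax] with x h₁ h₂ using le_antisymm h₂ h₁
  have : deriv (deriv g) a = 0 := by
    rw [hconst.deriv.deriv_eq]
    simp
  exact hneg.ne this

/-- The second derivative test along a line: `V` is a vector field whose integral curve through
`p` is the line `s ↦ p + s • v`, and `u - ε x²` has a local minimum at `p`. -/
theorem two_mul_mul_sq_le_of_isLocalMin {u : H1 → ℝ} {p v : H1} {V : H1 → H1} {ε : ℝ}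
    (hu : ContDiffAt ℝ 2 u p) (hV : DifferentiableAt ℝ V p) (hVv : ∀ s : ℝ, V (p + s • v) = v)
    (hmin : IsLocalMin (fun η => u η - ε * η.1 ^ 2) p) :
    2 * ε * v.1 ^ 2 ≤ fderiv ℝ (fun η => fderiv ℝ u η (V η)) p v := by
  set γ : ℝ → H1 := fun s => p + s • v with hγ
  have hγ0 : γ 0 = p := by simp [hγ]
  have hγc : Continuous γ := by fun_prop
  have hγt : Filter.Tendsto γ (nhds 0) (nhds p) := by
    simpa [hγ0] using hγc.tendsto 0
  have hγd : ∀ s, HasDerivAt γ v s := fun s => by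
    simpa [hγ] using ((hasDerivAt_id s).smul_const v).const_add p
  have hsq : ∀ s, HasDerivAt (fun s : ℝ => ε * (p.1 + s * v.1) ^ 2)
      (2 * ε * v.1 * (p.1 + s * v.1)) s := fun s => by
    have := ((((hasDerivAt_id s).mul_const v.1).const_add p.1).pow 2).const_mul ε
    refine this.congr_deriv ?_
    simp
    ring
  set g : ℝ → ℝ := fun s => u (γ s) - ε * (p.1 + s * v.1) ^ 2 with hg
  have hgmin : IsLocalMin g 0 := by
    have h : ∀ᶠ s in nhds (0 : ℝ),
        u p - ε * p.1 ^ 2 ≤ u (γ s) - ε * (γ s).1 ^ 2 := hγt.eventually hmin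
    filter_upwards [h] with s hs
    simpa [hg, hγ] using hs
  have hev : ∀ᶠ s in nhds (0 : ℝ), DifferentiableAt ℝ u (γ s) :=
    hγt.eventually ((hu.eventually (by simp)).mono fun η hη => hη.differentiableAt (by simp))
  have hderiv : deriv g =ᶠ[nhds 0]
      fun s => fderiv ℝ u (γ s) (V (γ s)) - 2 * ε * v.1 * (p.1 + s * v.1) := by
    filter_upwards [hev] with s hs
    rw [hVv s]
    exact ((hs.hasFDerivAt.comp_hasDerivAt s (hγd s)).sub (hsq s)).deriv
  have hdd : DifferentiableAt ℝ (fun η => fderiv ℝ u η (V η)) p :=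
    ((hu.fderiv_right (m := 1) (by norm_num)).differentiableAt (by simp)).clm_apply hV
  have hlin : HasDerivAt (fun s : ℝ => 2 * ε * v.1 * (p.1 + s * v.1)) (2 * ε * v.1 ^ 2) 0 := by
    have := (((hasDerivAt_id (0 : ℝ)).mul_const v.1).const_add p.1).const_mul (2 * ε * v.1)
    refine this.congr_deriv ?_
    ring
  have hsecond : deriv (deriv g) 0 =
      fderiv ℝ (fun η => fderiv ℝ u η (V η)) p v - 2 * ε * v.1 ^ 2 := by
    rw [hderiv.deriv_eq]
    have h₁ : HasFDerivAt (fun η => fderiv ℝ u η (V η))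
        (fderiv ℝ (fun η => fderiv ℝ u η (V η)) p) (γ 0) := by
      rw [hγ0]; exact hdd.hasFDerivAt
    exact ((h₁.comp_hasDerivAt 0 (hγd 0)).sub hlin).deriv
  have hgc : ContinuousAt g 0 := by
    have : DifferentiableAt ℝ u (γ 0) := hev.self_of_nhds
    exact ((this.hasFDerivAt.comp_hasDerivAt 0 (hγd 0)).sub (hsq 0)).continuousAt
  linarith [deriv_deriv_nonneg_of_isLocalMin hgc hgmin]

theorem two_mul_le_kohn_of_isLocalMin {u : H1 → ℝ} {p : H1} {ε : ℝ}
    (hu : ContDiffAt ℝ 2 u p) (hmin : IsLocalMin (fun η => u η - ε * η.1 ^ 2) p) :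
    2 * ε ≤ kohn u p := by
  have hX := two_mul_mul_sq_le_of_isLocalMin (v := (1, 0, 2 * p.2.1))
    (V := fun η => (1, 0, 2 * η.2.1)) hu (by fun_prop) (fun s => by simp) hmin
  have hY := two_mul_mul_sq_le_of_isLocalMin (v := (0, 1, -2 * p.1))
    (V := fun η => (0, 1, -2 * η.1)) hu (by fun_prop) (fun s => by simp) hmin
  simp only [one_pow, mul_one, ne_eq, OfNat.ofNat_ne_zero, not_false_eq_true, zero_pow,
    mul_zero] at hX hY
  exact (le_add_of_nonneg_right hY).trans' hX

/-- The weak minimum principle for the Kohn-Laplacian. -/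
theorem le_of_forall_frontier_le_of_kohn_eq_zero {Ω : Set H1} (hΩo : IsOpen Ω)
    (hΩb : Bornology.IsBounded Ω) {H : H1 → ℝ} (hHc : ContinuousOn H (closure Ω))
    (hHd : ContDiffOn ℝ 2 H Ω) (hHh : ∀ η ∈ Ω, kohn H η = 0) {m : ℝ}
    (hm : ∀ η ∈ frontier Ω, m ≤ H η) {ξ : H1} (hξ : ξ ∈ Ω) : m ≤ H ξ := by
  by_contra! hlt
  have hK : IsCompact (closure Ω) := hΩb.isCompact_closure
  have hξc : ξ ∈ closure Ω := subset_closure hξ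
  obtain ⟨q, -, hq⟩ := hK.exists_isMaxOn ⟨ξ, hξc⟩
    (f := fun η : H1 => η.1 ^ 2) (by fun_prop)
  set ε : ℝ := (m - H ξ) / (q.1 ^ 2 + 1) with hε
  have hε0 : 0 < ε := div_pos (by linarith) (by positivity)
  have hεm : ε * (q.1 ^ 2 + 1) = m - H ξ := div_mul_cancel₀ _ (by positivity)
  obtain ⟨p, hp, hpmin⟩ := hK.exists_isMinOn ⟨ξ, hξc⟩
    (f := fun η : H1 => H η - ε * η.1 ^ 2) (by fun_prop)
  have hpΩ : p ∈ Ω := by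
    by_contra hpn
    have h₁ : m ≤ H p := hm p (hΩo.frontier_eq ▸ ⟨hp, hpn⟩)
    have h₂ : H p - ε * p.1 ^ 2 ≤ H ξ - ε * ξ.1 ^ 2 := hpmin hξc
    have h₃ : p.1 ^ 2 ≤ q.1 ^ 2 := hq hp
    nlinarith [mul_le_mul_of_nonneg_left h₃ hε0.le, mul_nonneg hε0.le (sq_nonneg ξ.1)]
  have hloc : IsLocalMin (fun η : H1 => H η - ε * η.1 ^ 2) p :=
    hpmin.isLocalMin (Filter.mem_of_superset (hΩo.mem_nhds hpΩ) subset_closure)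
  have := two_mul_le_kohn_of_isLocalMin (hHd.contDiffAt (hΩo.mem_nhds hpΩ)) hloc
  rw [hHh p hpΩ] at this
  linarith

theorem kd_nonneg (ξ η : H1) : 0 ≤ kd ξ η := by
  unfold kd ρH
  positivity

theorem kd_pow_four (ξ η : H1) : kd ξ η ^ 4 =
    ((η.1 - ξ.1) ^ 2 + (η.2.1 - ξ.2.1) ^ 2) ^ 2 +
      (η.2.2 - (ξ.2.2 + 2 * (η.1 * ξ.2.1 - ξ.1 * η.2.1))) ^ 2 := by
  unfold kd ρH
  rw [← Real.rpow_natCast, ← Real.rpow_mul (by positivity)]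
  norm_num [hmul, hinv]
  ring

theorem continuous_kd (ξ : H1) : Continuous (kd ξ) := by
  unfold kd ρH hmul
  exact Continuous.rpow_const (by fun_prop) fun _ => Or.inr (by norm_num)

theorem kd_self (ξ : H1) : kd ξ ξ = 0 := by
  refine pow_eq_zero_iff (n := 4) (by norm_num) |>.1 ?_
  rw [kd_pow_four]
  ring

theorem eq_of_kd_eq_zero {ξ η : H1} (h : kd ξ η = 0) : η = ξ := by
  have h₄ := kd_pow_four ξ η
  rw [h, zero_pow (by norm_num)] at h₄
  have h₁ : (η.1 - ξ.1) ^ 2 + (η.2.1 - ξ.2.1) ^ 2 = 0 := by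
    refine pow_eq_zero_iff (n := 2) (by norm_num) |>.1 ?_
    nlinarith [sq_nonneg ((η.1 - ξ.1) ^ 2 + (η.2.1 - ξ.2.1) ^ 2),
      sq_nonneg (η.2.2 - (ξ.2.2 + 2 * (η.1 * ξ.2.1 - ξ.1 * η.2.1)))]
  have hx : η.1 = ξ.1 := by nlinarith [sq_nonneg (η.1 - ξ.1), sq_nonneg (η.2.1 - ξ.2.1)]
  have hy : η.2.1 = ξ.2.1 := by nlinarith [sq_nonneg (η.1 - ξ.1), sq_nonneg (η.2.1 - ξ.2.1)]
  rw [hx, hy] at h₄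
  have ht : η.2.2 = ξ.2.2 := by nlinarith [sq_nonneg (η.2.2 - ξ.2.2)]
  exact Prod.ext hx (Prod.ext hy ht)

theorem starConvex_kball (ξ : H1) (r : ℝ) : StarConvex ℝ ξ (kball ξ r) := by
  intro η hη a b ha hb hab
  refine lt_of_le_of_lt ?_ (show kd ξ η < r from hη)
  refine le_of_pow_le_pow_left₀ (n := 4) (by norm_num) (kd_nonneg _ _) ?_
  obtain rfl : a = 1 - b := by linarith
  have hb1 : b ^ 2 ≤ 1 := pow_le_one₀ hb (by linarith)
  have hb2 : b ^ 4 ≤ 1 := pow_le_one₀ hb (by linarith)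
  rw [kd_pow_four, kd_pow_four]
  simp only [Prod.fst_add, Prod.snd_add, Prod.smul_fst, Prod.smul_snd, smul_eq_mul]
  calc _ = b ^ 4 * ((η.1 - ξ.1) ^ 2 + (η.2.1 - ξ.2.1) ^ 2) ^ 2 +
        b ^ 2 * (η.2.2 - (ξ.2.2 + 2 * (η.1 * ξ.2.1 - ξ.1 * η.2.1))) ^ 2 := by ring
    _ ≤ _ := add_le_add (mul_le_of_le_one_left (sq_nonneg _) hb2)
        (mul_le_of_le_one_left (sq_nonneg _) hb1)

theorem kball_subset_of_forall_frontier_le {Ω : Set H1} (hΩo : IsOpen Ω) {ξ : H1} (hξ : ξ ∈ Ω)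
    {r : ℝ} (hr : 0 < r) (h : ∀ η ∈ frontier Ω, r ≤ kd ξ η) : kball ξ r ⊆ Ω := by
  have hξr : ξ ∈ kball ξ r := by simpa [kball, kd_self] using hr
  have hconn : IsPreconnected (kball ξ r) :=
    ((starConvex_kball ξ r).isPathConnected hξr).isConnected.isPreconnected
  refine hconn.subset_of_closure_inter_subset hΩo ⟨ξ, hξr, hξ⟩ ?_
  rintro η ⟨hηc, hη⟩
  by_contra hηΩ
  exact absurd (show kd ξ η < r from hη) (not_lt.2 (h η (hΩo.frontier_eq ▸ ⟨hηc, hηΩ⟩)))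

theorem volume_setOf_sq_add_sq_lt (a : ℝ) :
    volume {p : ℝ × ℝ | p.1 ^ 2 + p.2 ^ 2 < a} = ENNReal.ofReal (π * a) := by
  have hm : MeasurableSet {p : ℝ × ℝ | p.1 ^ 2 + p.2 ^ 2 < a} :=
    measurableSet_lt (by fun_prop) (by fun_prop)
  rw [← Complex.volume_preserving_equiv_real_prod.measure_preimage hm.nullMeasurableSet]
  have : Complex.measurableEquivRealProd ⁻¹' {p : ℝ × ℝ | p.1 ^ 2 + p.2 ^ 2 < a} =
      Metric.ball 0 (√a) := by
    ext z
    simp only [mem_preimage, mem_ofPred_eq, Complex.measurableEquivRealProd_apply,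
      mem_ball_zero_iff, Real.lt_sqrt (norm_nonneg z), Complex.sq_norm, Complex.normSq_apply, pow_two z.re,
      pow_two z.im]
  rw [this, Complex.volume_ball, mul_comm]
  rcases le_total 0 a with ha | ha
  · rw [← ENNReal.ofReal_pow (by positivity), Real.sq_sqrt ha,
      ENNReal.ofReal_mul pi_pos.le, ENNReal.ofReal_eq_coe_nnreal pi_pos.le]
    rfl
  · rw [Real.sqrt_eq_zero_of_nonpos ha, ENNReal.ofReal_of_nonpos (p := π * a)
      (mul_nonpos_of_nonneg_of_nonpos pi_pos.le ha)]
    simp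

theorem volume_setOf_sub_sq_lt (c a : ℝ) :
    volume {t : ℝ | (t - c) ^ 2 < a} = ENNReal.ofReal (2 * √a) := by
  have : {t : ℝ | (t - c) ^ 2 < a} = Metric.ball c (√a) := by
    ext t
    simp only [mem_ofPred_eq, Metric.mem_ball, Real.dist_eq, Real.lt_sqrt (abs_nonneg _), sq_abs]
  rw [this, Real.volume_ball]

theorem lintegral_two_mul_sqrt (a : ℝ) :
    ∫⁻ t : ℝ, ENNReal.ofReal (2 * √(a - t ^ 2)) = ENNReal.ofReal (π * a) := by
  have hm : MeasurableSet {p : ℝ × ℝ | p.1 ^ 2 + p.2 ^ 2 < a} :=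
    measurableSet_lt (by fun_prop) (by fun_prop)
  rw [← volume_setOf_sq_add_sq_lt, Measure.volume_eq_prod, Measure.prod_apply hm]
  refine lintegral_congr fun t => ?_
  rw [← volume_setOf_sub_sq_lt 0]
  congr 1
  ext s
  simp only [mem_ofPred_eq, mem_preimage, sub_zero, lt_sub_iff_add_lt']

theorem lintegral_two_mul_sqrt_sub_sq (a : ℝ) :
    ∫⁻ z : ℝ × ℝ, ENNReal.ofReal (2 * √(a - (z.1 ^ 2 + z.2 ^ 2) ^ 2)) =
      ENNReal.ofReal (π ^ 2 / 2 * a) := by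
  have hm : MeasurableSet {p : (ℝ × ℝ) × ℝ | (p.1.1 ^ 2 + p.1.2 ^ 2) ^ 2 + p.2 ^ 2 < a} :=
    measurableSet_lt (by fun_prop) (by fun_prop)
  have h₁ : ∫⁻ z : ℝ × ℝ, ENNReal.ofReal (2 * √(a - (z.1 ^ 2 + z.2 ^ 2) ^ 2)) =
      (volume.prod volume) {p : (ℝ × ℝ) × ℝ | (p.1.1 ^ 2 + p.1.2 ^ 2) ^ 2 + p.2 ^ 2 < a} := by
    rw [Measure.prod_apply hm]
    refine lintegral_congr fun z => ?_
    rw [← volume_setOf_sub_sq_lt 0]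
    congr 1
    ext s
    simp only [mem_ofPred_eq, mem_preimage, sub_zero, lt_sub_iff_add_lt']
  have h₂ : ∀ t : ℝ, volume ((fun z : ℝ × ℝ => (z, t)) ⁻¹'
      {p : (ℝ × ℝ) × ℝ | (p.1.1 ^ 2 + p.1.2 ^ 2) ^ 2 + p.2 ^ 2 < a}) =
      ENNReal.ofReal (π / 2) * ENNReal.ofReal (2 * √(a - t ^ 2)) := fun t => by
    rw [← ENNReal.ofReal_mul (by positivity), show π / 2 * (2 * √(a - t ^ 2)) =
      π * √(a - t ^ 2) by ring, ← volume_setOf_sq_add_sq_lt]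
    congr 1
    ext z
    simp only [mem_ofPred_eq, mem_preimage, Real.lt_sqrt (show 0 ≤ z.1 ^ 2 + z.2 ^ 2 by positivity),
      lt_sub_iff_add_lt]
  rw [h₁, Measure.prod_apply_symm hm, lintegral_congr h₂,
    lintegral_const_mul' _ _ ENNReal.ofReal_ne_top, lintegral_two_mul_sqrt,
    ← ENNReal.ofReal_mul (by positivity)]
  congr 1
  ring

theorem volume_kball (ξ : H1) {r : ℝ} (hr : 0 ≤ r) :
    volume (kball ξ r) = ENNReal.ofReal (π ^ 2 / 2 * r ^ 4) := by
  have hm : MeasurableSet (kball ξ r) :=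
    (isOpen_lt (continuous_kd ξ) continuous_const).measurableSet
  rw [← (volume_preserving_prodAssoc (α₁ := ℝ) (β₁ := ℝ) (γ₁ := ℝ)).measure_preimage
      hm.nullMeasurableSet, Measure.volume_eq_prod,
    Measure.prod_apply (MeasurableEquiv.prodAssoc.measurable hm),
    ← lintegral_two_mul_sqrt_sub_sq, ← lintegral_sub_right_eq_self
      (fun z : ℝ × ℝ => ENNReal.ofReal (2 * √(r ^ 4 - (z.1 ^ 2 + z.2 ^ 2) ^ 2))) (ξ.1, ξ.2.1)]
  refine lintegral_congr fun z => ?_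
  rw [← volume_setOf_sub_sq_lt (ξ.2.2 + 2 * (z.1 * ξ.2.1 - ξ.1 * z.2))]
  congr 1
  ext t
  simp only [mem_preimage, kball, mem_ofPred_eq, MeasurableEquiv.prodAssoc, MeasurableEquiv.coe_mk,
    Equiv.prodAssoc_apply, Prod.fst_sub, Prod.snd_sub]
  rw [← pow_lt_pow_iff_left₀ (kd_nonneg _ _) hr (four_ne_zero), kd_pow_four, lt_sub_iff_add_lt']

/-- r_Ω(ξ) ≤ α_Ω(ξ)·(2|Ω|/π²)^{1/4}, where
α_Ω(ξ) = (sup_{η∈∂Ω} d(ξ,η))/(inf_{η∈∂Ω} d(ξ,η)). -/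
theorem harmonic_radius_volume_bound (Ω : Set H1) (hΩo : IsOpen Ω)
    (hΩb : Bornology.IsBounded Ω) (hsm : smoothBdry Ω)
    (hu1 : uebp Ω) (hu2 : uebp (Set.univ \ closure Ω))
    (ξ : H1) (hξ : ξ ∈ Ω) (H : H1 → ℝ)
    (hHc : ContinuousOn H (closure Ω)) (hHd : ContDiffOn ℝ 2 H Ω)
    (hHh : ∀ η ∈ Ω, kohn H η = 0)
    (hHb : ∀ η ∈ frontier Ω, H η = Γξ ξ η)
    (hHξ : 0 < H ξ) :
    1 / Real.sqrt (8 * π * H ξ) ≤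
      (sSup (kd ξ '' frontier Ω) / sInf (kd ξ '' frontier Ω)) *
        (2 * (volume Ω).toReal / π ^ 2) ^ ((1 : ℝ) / 4) := by
  have hK : IsCompact (frontier Ω) :=
    hΩb.isCompact_closure.of_isClosed_subset isClosed_frontier frontier_subset_closure
  have hne : (frontier Ω).Nonempty := by
    refine nonempty_frontier_iff.2 ⟨⟨ξ, hξ⟩, fun h => ?_⟩
    exact NormedSpace.unbounded_univ ℝ H1 (h ▸ hΩb)
  have hpos : ∀ η ∈ frontier Ω, 0 < kd ξ η := fun η hη => by
    refine (kd_nonneg ξ η).lt_of_ne' fun h => ?_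
    rw [hΩo.frontier_eq, eq_of_kd_eq_zero h] at hη
    exact hη.2 hξ
  have hKi := hK.image (continuous_kd ξ)
  set R := sSup (kd ξ '' frontier Ω)
  set ρ := sInf (kd ξ '' frontier Ω)
  have hρ : 0 < ρ := by
    obtain ⟨η, hη, h⟩ := hKi.sInf_mem (hne.image _)
    exact (hpos η hη).trans_eq h
  have hρle : ∀ η ∈ frontier Ω, ρ ≤ kd ξ η := fun η hη =>
    csInf_le hKi.bddBelow (mem_image_of_mem _ hη)
  have hleR : ∀ η ∈ frontier Ω, kd ξ η ≤ R := fun η hη =>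
    le_csSup hKi.bddAbove (mem_image_of_mem _ hη)
  have hR : 0 < R := by
    obtain ⟨η, hη⟩ := hne
    exact (hpos η hη).trans_le (hleR η hη)
  have hH : 1 / (8 * π * R ^ 2) ≤ H ξ := by
    refine le_of_forall_frontier_le_of_kohn_eq_zero hΩo hΩb hHc hHd hHh (fun η hη => ?_) hξ
    have := hpos η hη
    rw [hHb η hη, Γξ]
    gcongr
    exact hleR η hη
  have hrad : 1 / √(8 * π * H ξ) ≤ R := by
    have h₁ : (1 / R) ^ 2 ≤ 8 * π * H ξ := by
      calc (1 / R) ^ 2 = 8 * π * (1 / (8 * π * R ^ 2)) := by field_simp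
        _ ≤ _ := by gcongr
    exact (one_div_le hR (by positivity)).1 (Real.le_sqrt_of_sq_le h₁)
  have hvol : π ^ 2 / 2 * ρ ^ 4 ≤ (volume Ω).toReal := by
    rw [← ENNReal.ofReal_le_iff_le_toReal hΩb.measure_lt_top.ne, ← volume_kball ξ hρ.le]
    exact measure_mono (kball_subset_of_forall_frontier_le hΩo hξ hρ hρle)
  have hρV : ρ ≤ (2 * (volume Ω).toReal / π ^ 2) ^ ((1 : ℝ) / 4) := by
    rw [one_div, Real.le_rpow_inv_iff_of_pos hρ.le (by positivity) (by norm_num)]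
    rw [le_div_iff₀ (by positivity)]
    norm_cast
    linarith
  calc 1 / √(8 * π * H ξ) ≤ R := hrad
    _ = R / ρ * ρ := by field_simp
    _ ≤ _ := by gcongr
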